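/- Let (α,β) be a pair of projective-space parameters and fix a real s with 0 < s < 2α+2. Set 𝒦_n(t) = ((α+β+2)_n/(β+1)_n) P_n^{(α+1,β)}(t) and I_s = Γ(α+β+2)Γ(α+1−s/2)/(Γ(α+1)Γ(α+β+2−s/2)). Then, as n → ∞, ∫_0^{π/2} sin(θ)^{−s} ( 𝒦_n(1)² − 𝒦_n(cos 2θ)² ) dν^{(α,β)}(θ) = I_s · 𝒦_n(1)² − [ Γ(s+1)Γ(α+1−s/2)Γ(β+1) / ( Γ(s/2+1)² Γ(α+2+s/2) Γ(α+1) Γ(α+β+2) ) ] · n^{s+2α+2} + O(n^{s+2α+1}). (This is the expected chordal Riesz s-energy of the harmonic ensemble with N = 𝒦_n(1) points.) -/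

import Mathlib

open MeasureTheory Finset Real Filter Asymptotics

/-- The Pochhammer symbol `(x)_n = x (x+1) ⋯ (x+n-1)`. -/
noncomputable def poch (x : ℝ) (n : ℕ) : ℝ := (ascPochhammer ℝ n).eval x

/-- The Jacobi polynomial `P_n^{(α,β)}`, via its standard explicit expansion
(equivalent to Rodrigues' formula). -/
noncomputable def jacobiP (α β : ℝ) (n : ℕ) (t : ℝ) : ℝ :=
  ∑ k ∈ Finset.range (n + 1),
    poch (α + k + 1) (n - k) / ((n - k).factorial : ℝ) *
      (poch (β + (n - k) + 1) k / (k.factorial : ℝ)) *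
      ((t - 1) / 2) ^ k * ((t + 1) / 2) ^ (n - k)

/-- The probability measure `ν^{(α,β)}` on `[0, π/2]` with density
`γ_{α,β}⁻¹ sin(θ)^{2α+1} cos(θ)^{2β+1}`, where
`γ_{α,β} = Γ(α+1)Γ(β+1)/(2Γ(α+β+2))`. -/
noncomputable def nuMeasure (α β : ℝ) : Measure ℝ :=
  (volume.restrict (Set.Ioo 0 (π / 2))).withDensity fun θ =>
    ENNReal.ofReal (2 * Real.Gamma (α + β + 2) / (Real.Gamma (α + 1) * Real.Gamma (β + 1)) *
      Real.sin θ ^ (2 * α + 1) * Real.cos θ ^ (2 * β + 1))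

/-- `(α,β)` is a pair of projective-space parameters, corresponding to
`ℝP^{d−1}`, `ℂP^{d−1}`, `ℍP^{d−1}` (`d ≥ 3`) or `𝕆P²`. -/
def IsProjParam (α β : ℝ) : Prop :=
  (∃ d : ℕ, 3 ≤ d ∧ α = ((d : ℝ) - 3) / 2 ∧ β = -(1 / 2)) ∨
  (∃ d : ℕ, 3 ≤ d ∧ α = (d : ℝ) - 2 ∧ β = 0) ∨
  (∃ d : ℕ, 3 ≤ d ∧ α = 2 * (d : ℝ) - 3 ∧ β = 1) ∨
  (α = 7 ∧ β = 3)

/-- The projection kernel `𝒦_n(t) = ((α+β+2)_n/(β+1)_n) P_n^{(α+1,β)}(t)`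
of the harmonic ensemble. -/
noncomputable def KK (α β : ℝ) (n : ℕ) (t : ℝ) : ℝ :=
  poch (α + β + 2) n / poch (β + 1) n * jacobiP (α + 1) β n t

theorem poch_zero (x : ℝ) : poch x 0 = 1 := by simp [poch]

theorem poch_succ (x : ℝ) (n : ℕ) : poch x (n + 1) = poch x n * (x + n) := by
  simp [poch, ascPochhammer_succ_eval]

theorem poch_pos {x : ℝ} (hx : 0 < x) (n : ℕ) : 0 < poch x n := ascPochhammer_pos n x hx

theorem poch_add (x : ℝ) (m n : ℕ) : poch x (m + n) = poch x m * poch (x + m) n := by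
  induction n with
  | zero => simp [poch_zero]
  | succ n ih => rw [← add_assoc, poch_succ, ih, poch_succ]; push_cast; ring

theorem Gamma_add_nat {x : ℝ} (hx : 0 < x) (n : ℕ) :
    Real.Gamma (x + n) = poch x n * Real.Gamma x := by
  induction n with
  | zero => simp [poch_zero]
  | succ n ih =>
    have : x + n ≠ 0 := by positivity
    rw [poch_succ, Nat.cast_succ, ← add_assoc, Real.Gamma_add_one this, ih]; ring

theorem poch_eq_choose (x : ℝ) (n : ℕ) :
    poch x n = n.factorial * Ring.choose (x + n - 1) n := by
  rw [← Ring.multichoose_eq, ← nsmul_eq_mul, Ring.factorial_nsmul_multichoose_eq_ascPochhammer,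
    Polynomial.ascPochhammer_smeval_eq_eval, poch]

theorem choose_succ_mul (x : ℝ) (n : ℕ) :
    (n + 1) * Ring.choose x (n + 1) = Ring.choose x n * (x - n) := by
  have h := Ring.choose_smul_choose x (Nat.le_succ n)
  simp only [Nat.succ_eq_add_one, Nat.choose_succ_self_right, Nat.add_sub_cancel_left,
    Ring.choose_one_right, nsmul_eq_mul] at h
  exact_mod_cast h

theorem neg_one_pow_mul_choose (y : ℝ) (k : ℕ) :
    (-1) ^ k * Ring.choose (y + k) k = Ring.choose (-(y + 1)) k := by
  rw [Ring.choose_neg]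
  have h : y + 1 + k - 1 = y + k := by ring
  rw [h]
  rcases Nat.even_or_odd k with hk | hk
  · simp [Int.negOnePow_even, hk]
  · simp [Int.negOnePow_odd, hk, hk.neg_one_pow]

theorem jacobiP_bernstein (γ β : ℝ) (n : ℕ) (x : ℝ) :
    jacobiP γ β n (1 - 2 * x) = ∑ k ∈ range (n + 1),
      Ring.choose (γ + n) (n - k) * Ring.choose (β + n) k * ((-x) ^ k * (1 - x) ^ (n - k)) := by
  refine Finset.sum_congr rfl fun k hk => ?_
  have hk' : k ≤ n := Nat.lt_succ_iff.1 (Finset.mem_range.1 hk)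
  rw [poch_eq_choose, poch_eq_choose,
    mul_div_cancel_left₀ _ (by positivity), mul_div_cancel_left₀ _ (by positivity)]
  push_cast [Nat.cast_sub hk']
  ring_nf

/-- Coefficient of `x ^ m` in `P_n^{(γ,β)}(1 - 2x)`. -/
noncomputable def jacobiCoeff (γ β : ℝ) (n m : ℕ) : ℝ :=
  (-1) ^ m * Ring.choose (γ + n) (n - m) * Ring.choose (n + γ + β + m) m

theorem jacobiP_monomial (γ β : ℝ) (n : ℕ) (x : ℝ) :
    jacobiP γ β n (1 - 2 * x) = ∑ m ∈ range (n + 1), jacobiCoeff γ β n m * x ^ m := by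
  rw [jacobiP_bernstein]
  have hexp : ∀ k ∈ range (n + 1), Ring.choose (γ + n) (n - k) * Ring.choose (β + n) k *
      ((-x) ^ k * (1 - x) ^ (n - k)) = ∑ j ∈ range (n + 1 - k), Ring.choose (γ + n) (n - k) *
        Ring.choose (β + n) k * ((-x) ^ (k + j) * ((n - k).choose j : ℝ)) := fun k hk => by
    have hk' : k ≤ n := Nat.lt_succ_iff.1 (Finset.mem_range.1 hk)
    rw [Nat.sub_add_comm hk', sub_eq_neg_add, add_pow, Finset.mul_sum, Finset.mul_sum]
    simp [pow_add, mul_assoc]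
  rw [Finset.sum_congr rfl hexp, ← Finset.sum_range_diag_flip (n + 1) fun k j =>
    Ring.choose (γ + n) (n - k) * Ring.choose (β + n) k *
      ((-x) ^ (k + j) * ((n - k).choose j : ℝ))]
  refine Finset.sum_congr rfl fun m hm => ?_
  have hm' : m ≤ n := Nat.lt_succ_iff.1 (Finset.mem_range.1 hm)
  have hv : Ring.choose (n + γ + β + m) m = ∑ k ∈ range (m + 1),
      Ring.choose (β + n) k * Ring.choose (γ + m) (m - k) := by
    rw [← Finset.Nat.sum_antidiagonal_eq_sum_range_succ
      (fun i j => Ring.choose (β + n) i * Ring.choose (γ + m) j),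
      ← Ring.add_choose_eq _ (Commute.all _ _)]
    congr 1; ring
  rw [jacobiCoeff, hv, Finset.mul_sum, Finset.sum_mul]
  refine Finset.sum_congr rfl fun k hk => ?_
  have hk' : k ≤ m := Nat.lt_succ_iff.1 (Finset.mem_range.1 hk)
  have h := Ring.choose_smul_choose (γ + n) (show n - m ≤ n - k by lia)
  rw [nsmul_eq_mul, ← Nat.choose_symm (show n - m ≤ n - k by lia), Nat.cast_sub hm',
    show n - k - (n - m) = m - k by lia, show γ + n - (n - m : ℝ) = γ + m by ring] at h
  rw [Nat.add_sub_cancel' hk', neg_pow]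
  linear_combination Ring.choose (β + n) k * ((-1) ^ m * x ^ m) * h

theorem integral_beta {u v : ℝ} (hu : -1 < u) (hv : -1 < v) :
    ∫ x in Set.Ioo (0 : ℝ) 1, x ^ u * (1 - x) ^ v =
      Real.Gamma (u + 1) * Real.Gamma (v + 1) / Real.Gamma (u + v + 2) := by
  have h := ProbabilityTheory.beta_eq_betaIntegralReal (u + 1) (v + 1) (by linarith) (by linarith)
  rw [ProbabilityTheory.beta, show u + 1 + (v + 1) = u + v + 2 by ring] at h
  rw [h, Complex.betaIntegral, intervalIntegral.integral_of_le zero_le_one,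
    ← integral_Ioc_eq_integral_Ioo]
  have hc := Complex.betaIntegral_convergent (u := ((u + 1 : ℝ) : ℂ)) (v := ((v + 1 : ℝ) : ℂ))
    (by simp; linarith) (by simp; linarith)
  rw [intervalIntegrable_iff_integrableOn_Ioc_of_le zero_le_one] at hc
  have := integral_re hc
  simp only [RCLike.re_to_complex] at this
  rw [← this]
  refine setIntegral_congr_fun measurableSet_Ioc fun x hx => ?_
  have h1 : 0 ≤ 1 - x := by linarith [hx.2]
  have e1 : ((u + 1 : ℝ) : ℂ) - 1 = (u : ℝ) := by push_cast; ring
  have e2 : ((v + 1 : ℝ) : ℂ) - 1 = (v : ℝ) := by push_cast; ring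
  rw [e1, e2, show (1 : ℂ) - x = ((1 - x : ℝ) : ℂ) by push_cast; ring,
    ← Complex.ofReal_cpow hx.1.le, ← Complex.ofReal_cpow h1, ← Complex.ofReal_mul,
    Complex.ofReal_re]

theorem integrableOn_beta {u v : ℝ} (hu : -1 < u) (hv : -1 < v) :
    IntegrableOn (fun x : ℝ => x ^ u * (1 - x) ^ v) (Set.Ioo (0 : ℝ) 1) := by
  by_contra hn
  have h := integral_beta hu hv
  rw [integral_undef hn] at h
  have h1 := Real.Gamma_pos_of_pos (show 0 < u + 1 by linarith)
  have h2 := Real.Gamma_pos_of_pos (show 0 < v + 1 by linarith)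
  have h3 := Real.Gamma_pos_of_pos (show 0 < u + v + 2 by linarith)
  exact (div_pos (mul_pos h1 h2) h3).ne h

theorem continuous_jacobiP (γ β : ℝ) (n : ℕ) : Continuous (jacobiP γ β n) := by
  unfold jacobiP; fun_prop

theorem integrableOn_beta_mul {u v : ℝ} (hu : -1 < u) (hv : -1 < v) {f : ℝ → ℝ}
    (hf : Continuous f) :
    IntegrableOn (fun x : ℝ => x ^ u * (1 - x) ^ v * f x) (Set.Ioo (0 : ℝ) 1) := by
  obtain ⟨C, hC⟩ := (isCompact_Icc (a := (0 : ℝ)) (b := 1)).exists_bound_of_continuousOn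
    hf.continuousOn
  refine Integrable.mul_bdd (c := C) (integrableOn_beta hu hv) hf.aestronglyMeasurable ?_
  exact (ae_restrict_iff' measurableSet_Ioo).2
    (Eventually.of_forall fun x hx => hC x (Set.Ioo_subset_Icc_self hx))

theorem integral_rpow_mul_jacobiP {b β : ℝ} (γ : ℝ) (hb : -1 < b) (hβ : -1 < β) (n : ℕ) :
    ∫ x in Set.Ioo (0 : ℝ) 1, x ^ b * (1 - x) ^ β * jacobiP γ β n (1 - 2 * x) =
      Real.Gamma (β + 1 + n) * Real.Gamma (b + 1) / Real.Gamma (b + β + n + 2) *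
        Ring.choose (n + γ - b - 1) n := by
  have h1 : ∀ x ∈ Set.Ioo (0 : ℝ) 1, x ^ b * (1 - x) ^ β * jacobiP γ β n (1 - 2 * x) =
      ∑ k ∈ range (n + 1), (-1) ^ k * Ring.choose (γ + n) (n - k) * Ring.choose (β + n) k *
        (x ^ (b + k) * (1 - x) ^ (β + (n - k : ℕ))) := fun x hx => by
    rw [jacobiP_bernstein, Finset.mul_sum]
    refine Finset.sum_congr rfl fun k _ => ?_
    have : 0 < 1 - x := by linarith [hx.2]
    rw [Real.rpow_add_natCast hx.1.ne', Real.rpow_add_natCast this.ne', neg_pow]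
    ring
  have hk0 : ∀ k : ℕ, (0 : ℝ) ≤ k := fun k => k.cast_nonneg
  have hu : ∀ k : ℕ, -1 < b + k := fun k => by linarith [hk0 k]
  have hv : ∀ k : ℕ, -1 < β + k := fun k => by linarith [hk0 k]
  rw [setIntegral_congr_fun measurableSet_Ioo h1, integral_finsetSum _ fun k _ =>
    (integrableOn_beta (hu k) (hv (n - k))).const_mul _]
  simp_rw [integral_const_mul, integral_beta (hu _) (hv _)]
  have hc : Ring.choose (n + γ - b - 1) n =
      ∑ k ∈ range (n + 1), Ring.choose (-(b + 1)) k * Ring.choose (γ + n) (n - k) := by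
    rw [← Finset.Nat.sum_antidiagonal_eq_sum_range_succ
      (fun i j => Ring.choose (-(b + 1)) i * Ring.choose (γ + n) j),
      ← Ring.add_choose_eq _ (Commute.all _ _)]
    congr 1; ring
  rw [hc, Finset.mul_sum]
  refine Finset.sum_congr rfl fun k hk => ?_
  have hk' : k ≤ n := Nat.lt_succ_iff.1 (Finset.mem_range.1 hk)
  have g1 : Real.Gamma (b + k + 1) =
      k.factorial * Ring.choose (b + k) k * Real.Gamma (b + 1) := by
    rw [show b + k + 1 = b + 1 + k by ring, Gamma_add_nat (by linarith), poch_eq_choose]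
    ring_nf
  have hw : 0 < β + 1 + (n - k : ℕ) := by linarith [hv (n - k)]
  have g2 : Real.Gamma (β + 1 + n) =
      k.factorial * Ring.choose (β + n) k * Real.Gamma (β + (n - k : ℕ) + 1) := by
    have : β + 1 + n = β + 1 + (n - k : ℕ) + k := by push_cast [Nat.cast_sub hk']; ring
    rw [this, Gamma_add_nat hw, poch_eq_choose, ← this]
    push_cast [Nat.cast_sub hk']
    ring_nf
  have e : b + k + (β + (n - k : ℕ)) + 2 = b + β + n + 2 := by push_cast [Nat.cast_sub hk']; ring
  rw [e, g1, g2, ← neg_one_pow_mul_choose]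
  ring

theorem jacobiCoeff_mul_choose {γ : ℝ} (β : ℝ) (hγ : -1 < γ) {σ : ℝ} (hσ : 0 < σ)
    {n m : ℕ} (hm : m ≤ n) :
    jacobiCoeff γ β n m * Ring.choose (n + σ - m) n =
      poch (γ + 1) n / n.factorial * (poch (σ + 1) n / n.factorial) *
        ((-1) ^ m * Ring.choose σ m / poch (γ + 1) m * poch (n + γ + β + 1) m *
          (n.descFactorial m / (m.factorial * Ring.choose (n + σ) m))) := by
  have h1 : Ring.choose (γ + n) (n - m) = poch (γ + 1) n * n.descFactorial m /
      (poch (γ + 1) m * n.factorial) := by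
    have p1 : poch (γ + 1) n =
        poch (γ + 1) m * ((n - m).factorial * Ring.choose (γ + n) (n - m)) := by
      have h := poch_add (γ + 1) m (n - m)
      rw [Nat.add_sub_cancel' hm, poch_eq_choose (γ + 1 + m)] at h
      rw [h]; push_cast [Nat.cast_sub hm]; ring_nf
    have p2 : (n.factorial : ℝ) = (n - m).factorial * n.descFactorial m := by
      exact_mod_cast (Nat.factorial_mul_descFactorial hm).symm
    have := poch_pos (show 0 < γ + 1 by linarith) m
    have := (Nat.factorial_pos n)
    rw [eq_div_iff (by positivity), p1, p2]; ring
  have h2 : Ring.choose (n + γ + β + m) m = poch (n + γ + β + 1) m / m.factorial := by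
    rw [poch_eq_choose, mul_div_cancel_left₀ _ (by positivity)]
    ring_nf
  have h3 : Ring.choose (n + σ - m) n * Ring.choose (n + σ) m =
      poch (σ + 1) n / n.factorial * Ring.choose σ m := by
    rw [poch_eq_choose, mul_div_cancel_left₀ _ (by positivity)]
    have a1 := Ring.choose_smul_choose (n + σ) (Nat.le_add_left m n)
    have a2 := Ring.choose_smul_choose (n + σ) (Nat.le_add_right n m)
    rw [Nat.add_sub_cancel] at a1
    rw [Nat.add_sub_cancel_left, Nat.choose_symm_add, a1] at a2
    ring_nf at a2 ⊢
    linarith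
  have h4 : 0 < Ring.choose (n + σ) m := by
    have h := poch_eq_choose (n + σ - m + 1) m
    have hc : (m : ℝ) ≤ n := by exact_mod_cast hm
    have := poch_pos (show 0 < n + σ - m + 1 by linarith) m
    rw [h] at this
    ring_nf at this ⊢
    exact pos_of_mul_pos_right this (by positivity)
  rw [← eq_div_iff h4.ne'] at h3
  have := (poch_pos (show 0 < γ + 1 by linarith) m).ne'
  rw [jacobiCoeff, h1, h2, h3]
  field_simp

/-- Summand of the Gauss hypergeometric series `₂F₁(-σ, a + 1; a + σ + 2; 1)`. -/
noncomputable def gaussTerm (a σ : ℝ) (m : ℕ) : ℝ :=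
  (-1) ^ m * Ring.choose σ m * (poch (a + 1) m / poch (a + σ + 2) m)

/-- The factor turning `gaussTerm` into the summand of the terminating balanced `₄F₃` series
for the weighted square integral of a Jacobi polynomial of degree `n`. -/
noncomputable def truncFactor (a β σ : ℝ) (n m : ℕ) : ℝ :=
  poch (n + a + β + 2 + σ) m / poch (n + a + β + 2) m *
    (n.descFactorial m / (m.factorial * Ring.choose (n + σ) m))

theorem integral_rpow_mul_jacobiP_sq {a β σ : ℝ} (ha : -1 < a) (hβ : -1 < β) (hσ : 0 < σ)
    (n : ℕ) :
    ∫ x in Set.Ioo (0 : ℝ) 1, x ^ a * (1 - x) ^ β * jacobiP (a + σ + 1) β n (1 - 2 * x) ^ 2 =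
      poch (β + 1) n / n.factorial * (poch (a + β + 2) n / n.factorial)⁻¹ *
        (poch (a + σ + 2) n / n.factorial) * (poch (σ + 1) n / n.factorial) *
        (Real.Gamma (β + 1) * Real.Gamma (a + 1) / Real.Gamma (a + β + 2)) *
        ∑ m ∈ range (n + 1), gaussTerm a σ m * truncFactor a β σ n m := by
  have h1 : ∀ x ∈ Set.Ioo (0 : ℝ) 1,
      x ^ a * (1 - x) ^ β * jacobiP (a + σ + 1) β n (1 - 2 * x) ^ 2 =
      ∑ m ∈ range (n + 1), jacobiCoeff (a + σ + 1) β n m *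
        (x ^ (a + m) * (1 - x) ^ β * jacobiP (a + σ + 1) β n (1 - 2 * x)) := fun x hx => by
    rw [sq, ← mul_assoc]
    nth_rw 2 [jacobiP_monomial]
    rw [Finset.mul_sum]
    refine Finset.sum_congr rfl fun m _ => ?_
    rw [Real.rpow_add_natCast hx.1.ne']
    ring
  have hu : ∀ k : ℕ, -1 < a + k := fun k => by linarith [(k.cast_nonneg : (0 : ℝ) ≤ k)]
  have hc : Continuous fun x : ℝ => jacobiP (a + σ + 1) β n (1 - 2 * x) :=
    (continuous_jacobiP _ β n).comp (by fun_prop)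
  rw [setIntegral_congr_fun measurableSet_Ioo h1, integral_finsetSum _ fun k _ =>
    (integrableOn_beta_mul (hu k) hβ hc).const_mul _]
  simp_rw [integral_const_mul, integral_rpow_mul_jacobiP _ (hu _) hβ]
  rw [Finset.mul_sum]
  refine Finset.sum_congr rfl fun m hm => ?_
  have hm' : m ≤ n := Nat.lt_succ_iff.1 (Finset.mem_range.1 hm)
  have h2 := jacobiCoeff_mul_choose β (show -1 < a + σ + 1 by linarith) hσ hm'
  have hn : (0 : ℝ) ≤ n := n.cast_nonneg
  have e : (n : ℝ) + (a + σ + 1) - (a + m) - 1 = n + σ - m := by ring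
  have g1 : Real.Gamma (a + m + 1) = poch (a + 1) m * Real.Gamma (a + 1) := by
    rw [show a + m + 1 = a + 1 + m by ring, Gamma_add_nat (by linarith)]
  have g2 : Real.Gamma (a + m + β + n + 2) =
      poch (n + a + β + 2) m * (poch (a + β + 2) n * Real.Gamma (a + β + 2)) := by
    rw [← Gamma_add_nat (by linarith), show a + m + β + n + 2 = n + a + β + 2 + m by ring,
      Gamma_add_nat (by linarith)]
    ring_nf
  rw [e, mul_left_comm, h2, g1, g2, Gamma_add_nat (by linarith), gaussTerm, truncFactor,
    show a + σ + 1 + 1 = a + σ + 2 by ring,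
    show (n : ℝ) + (a + σ + 1) + β + 1 = n + a + β + 2 + σ by ring]
  rw [inv_div]
  generalize hN : (n.factorial : ℝ) = N
  have hN0 : N ≠ 0 := by rw [← hN]; positivity
  simp only [div_eq_mul_inv, mul_inv]
  linear_combination (-poch (β + 1) n * (poch (a + β + 2) n)⁻¹ * poch (a + σ + 2) n *
    poch (σ + 1) n * N⁻¹ * N⁻¹ * Real.Gamma (β + 1) * Real.Gamma (a + 1) *
    (Real.Gamma (a + β + 2))⁻¹ * (-1) ^ m * Ring.choose σ m * poch (a + 1) m *
    (poch (a + σ + 2) m)⁻¹ * poch (n + a + β + 2 + σ) m * (poch (n + a + β + 2) m)⁻¹ *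
    n.descFactorial m * (m.factorial : ℝ)⁻¹ * (Ring.choose (n + σ) m)⁻¹) *
    mul_inv_cancel₀ hN0

/-- `f n = C n ^ p + O(n ^ (p - 1))` as `n → ∞`. -/
def HasLeadingTerm (f : ℕ → ℝ) (C p : ℝ) : Prop :=
  (fun n : ℕ => f n - C * (n : ℝ) ^ p) =O[atTop] fun n : ℕ => (n : ℝ) ^ (p - 1)

theorem rpow_natCast_isBigO {p q : ℝ} (h : p ≤ q) :
    (fun n : ℕ => (n : ℝ) ^ p) =O[atTop] fun n : ℕ => (n : ℝ) ^ q := by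
  refine IsBigO.of_bound 1 ((eventually_ge_atTop 1).mono fun n hn => ?_)
  have : (1 : ℝ) ≤ n := by exact_mod_cast hn
  rw [one_mul, Real.norm_of_nonneg (by positivity), Real.norm_of_nonneg (by positivity)]
  exact Real.rpow_le_rpow_of_exponent_le this h

theorem rpow_natCast_mul (p q : ℝ) :
    (fun n : ℕ => (n : ℝ) ^ p * (n : ℝ) ^ q) =ᶠ[atTop] fun n : ℕ => (n : ℝ) ^ (p + q) :=
  (eventually_gt_atTop 0).mono fun n hn => (Real.rpow_add (by exact_mod_cast hn) p q).symm

namespace HasLeadingTerm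

variable {f g : ℕ → ℝ} {C D p q : ℝ}

theorem isBigO (hf : HasLeadingTerm f C p) : f =O[atTop] fun n : ℕ => (n : ℝ) ^ p := by
  have := (hf.trans (rpow_natCast_isBigO (by linarith : p - 1 ≤ p))).add
    ((isBigO_refl (fun n : ℕ => (n : ℝ) ^ p) atTop).const_mul_left C)
  simpa using this

theorem congr' (hf : HasLeadingTerm f C p) (h : f =ᶠ[atTop] g) : HasLeadingTerm g C p :=
  IsBigO.congr' hf (h.mono fun n hn => by simp [hn]) EventuallyEq.rfl

theorem const (C : ℝ) : HasLeadingTerm (fun _ => C) C 0 := by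
  simp [HasLeadingTerm, isBigO_zero]

theorem mul (hf : HasLeadingTerm f C p) (hg : HasLeadingTerm g D q) :
    HasLeadingTerm (fun n => f n * g n) (C * D) (p + q) := by
  have h1 := (IsBigO.mul hf hg.isBigO).trans_eventuallyEq (rpow_natCast_mul (p - 1) q)
  have h2 := ((isBigO_refl (fun n : ℕ => (n : ℝ) ^ p) atTop).const_mul_left C).mul hg
  have h3 := h2.trans_eventuallyEq (rpow_natCast_mul p (q - 1))
  rw [show p - 1 + q = p + q - 1 by ring] at h1
  rw [show p + (q - 1) = p + q - 1 by ring] at h3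
  refine (h1.add h3).congr' ?_ EventuallyEq.rfl
  filter_upwards [rpow_natCast_mul p q] with n hn
  rw [← hn]; ring

theorem inv (hf : HasLeadingTerm f C p) (hC : C ≠ 0) :
    HasLeadingTerm (fun n => (f n)⁻¹) C⁻¹ (-p) := by
  have hlo : (fun n : ℕ => f n - C * (n : ℝ) ^ p) =o[atTop] fun n : ℕ => C * (n : ℝ) ^ p := by
    refine (hf.trans_isLittleO ?_).const_mul_right hC
    refine (isLittleO_iff_tendsto' ?_).2 ?_
    · filter_upwards [eventually_gt_atTop 0] with n hn h0
      have : (0 : ℝ) < (n : ℝ) ^ p := Real.rpow_pos_of_pos (by exact_mod_cast hn) _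
      exact absurd h0 this.ne'
    · refine (tendsto_inv_atTop_nhds_zero_nat (𝕜 := ℝ)).congr' ?_
      filter_upwards [eventually_gt_atTop 0] with n hn
      have : (0 : ℝ) < n := by exact_mod_cast hn
      rw [← Real.rpow_sub this, show p - 1 - p = -1 by ring, Real.rpow_neg_one]
  have heq : f ~[atTop] fun n : ℕ => C * (n : ℝ) ^ p := hlo
  have hinv := heq.inv.isBigO
  have hinv' : (fun n => (f n)⁻¹) =O[atTop] fun n : ℕ => (n : ℝ) ^ (-p) := by
    refine hinv.trans ?_
    refine IsBigO.congr' ((isBigO_refl (fun n : ℕ => (n : ℝ) ^ (-p)) atTop).const_mul_left C⁻¹)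
      (Eventually.of_forall fun n => ?_) EventuallyEq.rfl
    simp [Real.rpow_neg, mul_comm]
  have hmul := (hinv'.mul hf).mul
    ((isBigO_refl (fun n : ℕ => (n : ℝ) ^ (-p)) atTop).const_mul_left (-C⁻¹))
  refine IsBigO.congr' hmul ?_ ?_
  · have hne : ∀ᶠ n in atTop, f n ≠ 0 := by
      refine heq.symm.isBigO.eq_zero_imp.mp ?_
      filter_upwards [eventually_gt_atTop 0] with n hn h h0
      have : (0 : ℝ) < (n : ℝ) ^ p := Real.rpow_pos_of_pos (by exact_mod_cast hn) _
      exact mul_ne_zero hC this.ne' (h h0)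
    filter_upwards [hne, eventually_gt_atTop 0] with n hn hn0
    have : (0 : ℝ) < (n : ℝ) ^ p := Real.rpow_pos_of_pos (by exact_mod_cast hn0) _
    rw [Real.rpow_neg n.cast_nonneg]
    field_simp
    ring
  · filter_upwards [eventually_gt_atTop 0] with n hn
    have : (0 : ℝ) < n := by exact_mod_cast hn
    rw [← Real.rpow_add this, ← Real.rpow_add this]
    ring_nf

end HasLeadingTerm

theorem hasLeadingTerm_add_const (x : ℝ) : HasLeadingTerm (fun n : ℕ => n + x) 1 1 := by
  simp [HasLeadingTerm, isBoundedUnder_const]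

theorem hasLeadingTerm_poch_of_le_one {x : ℝ} (hx : 0 < x) (hx1 : x ≤ 1) :
    HasLeadingTerm (fun n => poch x n / n.factorial) (Real.Gamma x)⁻¹ (x - 1) := by
  refine IsBigO.of_bound (Real.Gamma x)⁻¹ ((eventually_ge_atTop 2).mono fun n hn => ?_)
  have hn2 : (2 : ℝ) ≤ n := by exact_mod_cast hn
  have hn0 : (0 : ℝ) < n := by linarith
  have hG := Real.Gamma_pos_of_pos hx
  have hGn := Real.Gamma_pos_of_pos hn0
  have hGx := Real.Gamma_pos_of_pos (add_pos hn0 hx)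
  have feq : ∀ {y : ℝ}, 0 < y → (Real.log ∘ Real.Gamma) (y + 1) =
      (Real.log ∘ Real.Gamma) y + Real.log y := fun {y} hy => by
    rw [Function.comp_apply, Real.Gamma_add_one hy.ne',
      Real.log_mul hy.ne' (Real.Gamma_pos_of_pos hy).ne', add_comm, Function.comp_apply]
  have hu := Real.BohrMollerup.f_add_nat_le Real.convexOn_log_Gamma feq (by lia : n ≠ 0) hx hx1
  have hl := Real.BohrMollerup.f_add_nat_ge Real.convexOn_log_Gamma feq hn hx
  have hn1 : (0 : ℝ) < n - 1 := by linarith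
  simp only [Function.comp_apply] at hu hl
  rw [← Real.log_rpow hn0, ← Real.log_mul hGn.ne' (by positivity),
    Real.log_le_log_iff hGx (by positivity)] at hu
  rw [← Real.log_rpow hn1, ← Real.log_mul hGn.ne' (by positivity),
    Real.log_le_log_iff (by positivity) hGx] at hl
  have hl2 : (n : ℝ) ^ x - (n : ℝ) ^ (x - 1) ≤ ((n : ℝ) - 1) ^ x := by
    have h1 : (n - 1) / n ≤ ((n - 1) / n : ℝ) ^ x := by
      conv_lhs => rw [← Real.rpow_one ((n - 1) / n : ℝ)]
      exact Real.rpow_le_rpow_of_exponent_ge (by positivity)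
        ((div_le_one hn0).2 (by linarith)) hx1
    rw [Real.div_rpow hn1.le hn0.le, le_div_iff₀ (by positivity)] at h1
    refine le_trans (le_of_eq ?_) h1
    rw [Real.rpow_sub_one hn0.ne']
    field_simp
  have hp : poch x n / n.factorial = Real.Gamma (n + x) / (Real.Gamma x * (n * Real.Gamma n)) := by
    rw [← Real.Gamma_add_one hn0.ne', Real.Gamma_nat_eq_factorial, add_comm (n : ℝ),
      Gamma_add_nat hx]
    field_simp
  have e1 : (n : ℝ) ^ (x - 1) = (n : ℝ) ^ x / n := Real.rpow_sub_one hn0.ne' x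
  have e2 : (n : ℝ) ^ (x - 1 - 1) = (n : ℝ) ^ (x - 1) / n := Real.rpow_sub_one hn0.ne' _
  rw [Real.norm_of_nonneg (by positivity : 0 ≤ (n : ℝ) ^ (x - 1 - 1)), Real.norm_eq_abs]
  beta_reduce
  rw [hp]
  have e3 : Real.Gamma (n + x) / (Real.Gamma x * (n * Real.Gamma n)) -
      (Real.Gamma x)⁻¹ * (n : ℝ) ^ (x - 1) =
      (Real.Gamma x)⁻¹ * ((Real.Gamma (n + x) / Real.Gamma n - (n : ℝ) ^ x) / n) := by
    rw [e1]; field_simp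
  rw [e3, abs_mul, abs_of_pos (inv_pos.2 hG), e2, abs_div, abs_of_pos hn0]
  gcongr
  rw [abs_le]
  constructor
  · rw [neg_le_sub_iff_le_add, ← sub_le_iff_le_add, le_div_iff₀ hGn]
    nlinarith
  · rw [sub_le_iff_le_add, div_le_iff₀ hGn]
    have : 0 ≤ (n : ℝ) ^ (x - 1) := by positivity
    nlinarith

theorem mul_poch_add_one (x : ℝ) (n : ℕ) : x * poch (x + 1) n = poch x n * (x + n) := by
  rw [← poch_succ, add_comm n 1, poch_add, poch_succ, poch_zero]
  simp

theorem hasLeadingTerm_poch {x : ℝ} (hx : 0 < x) :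
    HasLeadingTerm (fun n => poch x n / n.factorial) (Real.Gamma x)⁻¹ (x - 1) := by
  obtain ⟨k, hk⟩ := exists_nat_ge x
  induction k generalizing x with
  | zero => simp at hk; linarith
  | succ k ih =>
    rcases le_or_gt x 1 with h | h
    · exact hasLeadingTerm_poch_of_le_one hx h
    · have hx' : 0 < x - 1 := by linarith
      have h1 := ih hx' (by push_cast at hk; linarith)
      have h2 := (h1.mul (hasLeadingTerm_add_const (x - 1))).mul (.const (x - 1)⁻¹)
      have hG : Real.Gamma x = (x - 1) * Real.Gamma (x - 1) := by
        rw [← Real.Gamma_add_one hx'.ne']; ring_nf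
      rw [hG]
      convert h2 using 1
      · ext n
        have := mul_poch_add_one (x - 1) n
        rw [sub_add_cancel] at this
        field_simp
        linarith
      · rw [mul_inv]; ring
      · ring

theorem poch_isBigO (x : ℝ) :
    (fun n => poch x n / n.factorial) =O[atTop] fun n : ℕ => (n : ℝ) ^ (x - 1) := by
  obtain ⟨k, hk⟩ := exists_nat_gt (-x)
  induction k generalizing x with
  | zero => exact (hasLeadingTerm_poch (by simpa using hk)).isBigO
  | succ k ih =>
    have h := ih (x + 1) (by push_cast at hk; linarith)
    have h1 := ((hasLeadingTerm_add_const x).inv one_ne_zero).isBigO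
    have h2 := ((h.mul h1).const_mul_left x).trans_eventuallyEq (rpow_natCast_mul _ _)
    refine IsBigO.congr' h2 ?_ (Eventually.of_forall fun n => by ring_nf)
    filter_upwards [eventually_gt_atTop ⌈-x⌉₊] with n hn
    have : 0 < n + x := by linarith [Nat.lt_of_ceil_lt hn]
    have := mul_poch_add_one x n
    field_simp
    linarith

theorem neg_one_pow_mul_choose_eq_poch (σ : ℝ) (m : ℕ) :
    (-1) ^ m * Ring.choose σ m = poch (-σ) m / m.factorial := by
  have h := neg_one_pow_mul_choose (-σ - 1) m
  rw [show -(-σ - 1 + 1) = σ by ring] at h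
  rw [poch_eq_choose, mul_div_cancel_left₀ _ (by positivity), ← h, ← mul_assoc, ← mul_pow]
  norm_num
  ring_nf

theorem summable_natCast_mul_gaussTerm {a σ : ℝ} (ha : -1 < a) (hσ : 0 < σ) :
    Summable fun m : ℕ => (m : ℝ) * |gaussTerm a σ m| := by
  have h1 := poch_isBigO (-σ)
  have h2 := poch_isBigO (a + 1)
  have h3 := ((hasLeadingTerm_poch (show 0 < a + σ + 2 by linarith)).inv
    (inv_ne_zero (Real.Gamma_pos_of_pos (by linarith)).ne')).isBigO
  have h4 := (((h1.mul h2).trans_eventuallyEq (rpow_natCast_mul _ _)).mul h3).trans_eventuallyEq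
    (rpow_natCast_mul _ _)
  have h5 := (((hasLeadingTerm_add_const 0).isBigO.mul h4).trans_eventuallyEq
    (rpow_natCast_mul _ _)).norm_left
  refine summable_of_isBigO_nat (Real.summable_nat_rpow.2 ?_) (h5.congr_left fun m => ?_)
  · linarith
  · rw [add_zero, norm_mul, Real.norm_of_nonneg m.cast_nonneg, Real.norm_eq_abs, gaussTerm,
      neg_one_pow_mul_choose_eq_poch]
    have : (m.factorial : ℝ) ≠ 0 := by positivity
    congr 2
    rw [inv_div, mul_assoc, div_mul_div_cancel₀ this]

theorem summable_abs_gaussTerm {a σ : ℝ} (ha : -1 < a) (hσ : 0 < σ) :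
    Summable fun m : ℕ => |gaussTerm a σ m| := by
  refine summable_of_isBigO_nat (summable_natCast_mul_gaussTerm ha hσ)
    (IsBigO.of_bound 1 ((eventually_ge_atTop 1).mono fun m hm => ?_))
  have : (1 : ℝ) ≤ m := by exact_mod_cast hm
  rw [one_mul, Real.norm_of_nonneg (abs_nonneg _), Real.norm_of_nonneg (by positivity)]
  exact le_mul_of_one_le_left (abs_nonneg _) this

theorem hasSum_choose_mul_neg_pow (σ : ℝ) {x : ℝ} (hx0 : 0 ≤ x) (hx1 : x < 1) :
    HasSum (fun m : ℕ => (-1) ^ m * Ring.choose σ m * x ^ m) ((1 - x) ^ σ) := by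
  have h := (Real.one_add_rpow_hasFPowerSeriesOnBall_zero (a := σ)).hasSum (y := -x)
    (by simp [enorm_eq_nnnorm, ← NNReal.coe_lt_one, abs_of_nonneg hx0, hx1])
  rw [zero_add, ← sub_eq_add_neg] at h
  refine h.congr_fun fun m => ?_
  rw [binomialSeries_apply, List.ofFn_const, List.prod_replicate, smul_eq_mul, neg_pow]
  ring

/-- The Gauss summation theorem for `₂F₁(-σ, a + 1; a + σ + 2; 1)`. -/
theorem hasSum_gaussTerm {a σ : ℝ} (ha : -1 < a) (hσ : 0 < σ) :
    HasSum (gaussTerm a σ) (Real.Gamma (a + σ + 2) * Real.Gamma (2 * σ + 1) /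
      (Real.Gamma (a + 2 * σ + 2) * Real.Gamma (σ + 1))) := by
  have hu : ∀ k : ℕ, -1 < a + k := fun k => by linarith [(k.cast_nonneg : (0 : ℝ) ≤ k)]
  have hσ' : -1 < σ := by linarith
  have hG1 := Real.Gamma_pos_of_pos (show 0 < a + 1 by linarith)
  have hG2 := Real.Gamma_pos_of_pos (show 0 < σ + 1 by linarith)
  have hG3 := Real.Gamma_pos_of_pos (show 0 < a + σ + 2 by linarith)
  have hG4 := Real.Gamma_pos_of_pos (show 0 < a + 2 * σ + 2 by linarith)
  set B := Real.Gamma (a + 1) * Real.Gamma (σ + 1) / Real.Gamma (a + σ + 2) with hB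
  have hB0 : 0 < B := by positivity
  have hbeta : ∀ m : ℕ, ∫ x in Set.Ioo (0 : ℝ) 1, x ^ (a + m) * (1 - x) ^ σ =
      B * (poch (a + 1) m / poch (a + σ + 2) m) := fun m => by
    rw [integral_beta (hu m) hσ', show a + m + 1 = a + 1 + m by ring,
      show a + m + σ + 2 = a + σ + 2 + m by ring, Gamma_add_nat (by linarith),
      Gamma_add_nat (by linarith), hB]
    have := (poch_pos (show 0 < a + σ + 2 by linarith) m).ne'
    field_simp
  have hF : ∀ m : ℕ, IntegrableOn (fun x : ℝ => (-1) ^ m * Ring.choose σ m *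
      (x ^ (a + m) * (1 - x) ^ σ)) (Set.Ioo 0 1) := fun m =>
    (integrableOn_beta (hu m) hσ').const_mul _
  have hnorm : ∀ m : ℕ, ∫ x in Set.Ioo (0 : ℝ) 1,
      ‖(-1) ^ m * Ring.choose σ m * (x ^ (a + m) * (1 - x) ^ σ)‖ = B * |gaussTerm a σ m| :=
    fun m => by
    have e : ∀ x ∈ Set.Ioo (0 : ℝ) 1,
        ‖(-1) ^ m * Ring.choose σ m * (x ^ (a + m) * (1 - x) ^ σ)‖ =
        |(-1) ^ m * Ring.choose σ m| * (x ^ (a + m) * (1 - x) ^ σ) := fun x hx => by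
      have h0 := hx.1
      have h1 : 0 < 1 - x := by linarith [hx.2]
      rw [Real.norm_eq_abs, abs_mul, abs_of_nonneg (by positivity : 0 ≤ x ^ (a + m) * (1 - x) ^ σ)]
    rw [setIntegral_congr_fun measurableSet_Ioo e, integral_const_mul, hbeta, gaussTerm, abs_mul _
      (poch (a + 1) m / poch (a + σ + 2) m), abs_of_pos (div_pos (poch_pos (by linarith) m)
      (poch_pos (by linarith) m) : 0 < poch (a + 1) m / poch (a + σ + 2) m)]
    ring
  have hsum := hasSum_integral_of_summable_integral_norm hF
    (by simpa only [hnorm] using (summable_abs_gaussTerm ha hσ).mul_left B)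
  have hlim : ∀ x ∈ Set.Ioo (0 : ℝ) 1, ∑' m : ℕ, (-1) ^ m * Ring.choose σ m *
      (x ^ (a + m) * (1 - x) ^ σ) = x ^ a * (1 - x) ^ (2 * σ) := fun x hx => by
    have h1 : 0 < 1 - x := by linarith [hx.2]
    rw [two_mul, Real.rpow_add h1, ← mul_assoc]
    refine (((hasSum_choose_mul_neg_pow σ hx.1.le hx.2).mul_left _).congr_fun fun m => ?_).tsum_eq
    rw [Real.rpow_add_natCast hx.1.ne']
    ring
  rw [setIntegral_congr_fun measurableSet_Ioo hlim, integral_beta ha (by linarith)] at hsum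
  simp only [integral_const_mul, hbeta] at hsum
  have e : Real.Gamma (a + σ + 2) * Real.Gamma (2 * σ + 1) /
      (Real.Gamma (a + 2 * σ + 2) * Real.Gamma (σ + 1)) =
      B⁻¹ * (Real.Gamma (a + 1) * Real.Gamma (2 * σ + 1) / Real.Gamma (a + 2 * σ + 2)) := by
    rw [hB]
    field_simp
  rw [e]
  refine (hsum.mul_left B⁻¹).congr_fun fun m => ?_
  rw [gaussTerm]
  field_simp

theorem descFactorial_div_choose_succ {n m : ℕ} (hm : m ≤ n) {σ : ℝ} (hσ : 0 < σ) :
    ((n.descFactorial (m + 1) : ℝ) / ((m + 1).factorial * Ring.choose (n + σ) (m + 1))) =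
      n.descFactorial m / (m.factorial * Ring.choose (n + σ) m) * (1 - σ / (n + σ - m)) := by
  have hm' : (m : ℝ) ≤ n := by exact_mod_cast hm
  have h : n + σ - m ≠ 0 := by linarith
  rw [Nat.descFactorial_succ, Nat.factorial_succ, one_sub_div h]
  push_cast [Nat.cast_sub hm]
  rw [mul_assoc, mul_left_comm, choose_succ_mul, ← mul_assoc, mul_comm (n - m : ℝ),
    mul_div_mul_comm]
  ring_nf

theorem descFactorial_div_choose_bounds {n m : ℕ} (hn : 0 < n) (hm : m ≤ n) {σ : ℝ}
    (hσ : 0 < σ) :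
    0 ≤ n.descFactorial m / (m.factorial * Ring.choose (n + σ) m) ∧
      n.descFactorial m / (m.factorial * Ring.choose (n + σ) m) ≤ 1 ∧
      1 - 2 * (σ + 1) * (m / n) ≤ n.descFactorial m / (m.factorial * Ring.choose (n + σ) m) := by
  have hn' : (0 : ℝ) < n := by exact_mod_cast hn
  induction m with
  | zero => simp
  | succ m ih =>
    obtain ⟨h0, h1, h2⟩ := ih (by lia)
    have hm' : (m : ℝ) + 1 ≤ n := by exact_mod_cast hm
    rw [descFactorial_div_choose_succ (by lia) hσ]
    set v := n.descFactorial m / (m.factorial * Ring.choose (n + σ) m)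
    have hd : 0 < n + σ - m := by linarith
    have hq0 : 0 ≤ σ / (n + σ - m) := by positivity
    have hq1 : σ / (n + σ - m) ≤ 1 := (div_le_one hd).2 (by linarith)
    have hpos : 0 ≤ v * (1 - σ / (n + σ - m)) := mul_nonneg h0 (by linarith)
    refine ⟨hpos, mul_le_one₀ h1 (by linarith) (by linarith), ?_⟩
    push_cast
    rcases le_or_gt (n : ℝ) (2 * (m + 1)) with h | h
    · refine le_trans ?_ hpos
      have : 1 / 2 ≤ (m + 1 : ℝ) / n := by rw [le_div_iff₀ hn']; linarith
      nlinarith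
    · have hq2 : σ / (n + σ - m) ≤ 2 * σ / n := by
        rw [div_le_div_iff₀ hd hn']; nlinarith
      have e : (m + 1 : ℝ) / n = m / n + 1 / n := add_div _ _ _
      have e2 : 2 * (σ + 1) * (1 / n) = 2 * σ / n + 2 / n := by ring
      have : 0 < 2 / (n : ℝ) := by positivity
      rw [e, mul_add, e2]
      nlinarith

theorem poch_add_div_poch_bounds {c σ : ℝ} (hσ : 0 ≤ σ) {n : ℕ} (hn : 0 < n) (hc : (n : ℝ) ≤ c)
    (m : ℕ) :
    1 ≤ poch (c + σ) m / poch c m ∧ poch (c + σ) m / poch c m ≤ Real.exp (σ * (m / n)) := by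
  have hn' : (0 : ℝ) < n := by exact_mod_cast hn
  induction m with
  | zero => simp [poch_zero]
  | succ m ih =>
    have hm : (0 : ℝ) ≤ m := m.cast_nonneg
    have hd : 0 < c + m := by linarith
    have e : (c + σ + m) / (c + m) = σ / (c + m) + 1 := by field_simp; ring
    rw [poch_succ, poch_succ, mul_div_mul_comm, e]
    have h0 : 0 ≤ σ / (c + m) := by positivity
    refine ⟨one_le_mul_of_one_le_of_one_le ih.1 (by linarith), ?_⟩
    have e2 : σ * ((m + 1 : ℕ) / n) = σ * (m / n) + σ / n := by push_cast; ring
    rw [e2, Real.exp_add]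
    have h1 : σ / (c + m) ≤ σ / n := by gcongr; linarith
    exact mul_le_mul ih.2 ((Real.add_one_le_exp _).trans (Real.exp_le_exp.2 h1)) (by linarith)
      (by positivity)

theorem abs_truncFactor_sub_one_le {a β σ : ℝ} (ha : -1 < a) (hβ : -1 < β) (hσ : 0 < σ)
    {n m : ℕ} (hn : 0 < n) (hm : m ≤ n) :
    |truncFactor a β σ n m - 1| ≤ (σ * Real.exp σ + 2 * (σ + 1)) * (m / n) := by
  have hn' : (0 : ℝ) < n := by exact_mod_cast hn
  obtain ⟨v0, v1, v2⟩ := descFactorial_div_choose_bounds hn hm hσ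
  obtain ⟨u1, u2⟩ := poch_add_div_poch_bounds hσ.le hn
    (show (n : ℝ) ≤ n + a + β + 2 by linarith) m
  rw [truncFactor]
  set v := n.descFactorial m / (m.factorial * Ring.choose (n + σ) m)
  set u := poch (n + a + β + 2 + σ) m / poch (n + a + β + 2) m
  set y : ℝ := m / n with hy
  have hy0 : 0 ≤ y := by positivity
  have hy1 : y ≤ 1 := (div_le_one hn').2 (by exact_mod_cast hm)
  have hexp : Real.exp (σ * y) - 1 ≤ σ * y * Real.exp σ := by
    have h := Real.one_sub_le_exp_neg (σ * y)
    have h2 : Real.exp (-(σ * y)) * Real.exp (σ * y) = 1 := by rw [← Real.exp_add]; simp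
    have h3 : Real.exp (σ * y) ≤ Real.exp σ := Real.exp_le_exp.2 (by nlinarith)
    have h4 : 0 ≤ σ * y := by positivity
    nlinarith [mul_le_mul_of_nonneg_right h (Real.exp_pos (σ * y)).le]
  have e : u * v - 1 = (u - 1) * v + (v - 1) := by ring
  rw [e]
  refine (abs_add_le _ _).trans ?_
  rw [abs_of_nonneg (mul_nonneg (by linarith) v0), abs_of_nonpos (by linarith)]
  nlinarith [mul_le_mul_of_nonneg_left v1 (by linarith : 0 ≤ u - 1)]

theorem hasLeadingTerm_sum_gaussTerm_mul_truncFactor {a β σ : ℝ} (ha : -1 < a) (hβ : -1 < β)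
    (hσ : 0 < σ) :
    HasLeadingTerm (fun n => ∑ m ∈ range (n + 1), gaussTerm a σ m * truncFactor a β σ n m)
      (Real.Gamma (a + σ + 2) * Real.Gamma (2 * σ + 1) /
        (Real.Gamma (a + 2 * σ + 2) * Real.Gamma (σ + 1))) 0 := by
  have hS := summable_natCast_mul_gaussTerm ha hσ
  have hG := hasSum_gaussTerm ha hσ
  set K := σ * Real.exp σ + 2 * (σ + 1) with hK
  have hK1 : 1 ≤ K := by have := Real.exp_pos σ; nlinarith
  refine IsBigO.of_bound (K * ∑' m : ℕ, (m : ℝ) * |gaussTerm a σ m|)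
    ((eventually_gt_atTop 0).mono fun n hn => ?_)
  have hn' : (0 : ℝ) < n := by exact_mod_cast hn
  rw [Real.rpow_zero, mul_one, zero_sub, Real.rpow_neg_one,
    Real.norm_of_nonneg (by positivity : (0 : ℝ) ≤ (n : ℝ)⁻¹)]
  set T : ℕ → ℝ := fun m => if m ∈ range (n + 1) then truncFactor a β σ n m else 0 with hT
  have hT1 : ∀ m, |T m - 1| ≤ K * (m / n) := fun m => by
    simp only [hT]
    split_ifs with h
    · exact abs_truncFactor_sub_one_le ha hβ hσ hn (Nat.lt_succ_iff.1 (Finset.mem_range.1 h))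
    · have hm : (n : ℝ) ≤ m := by
        have : n ≤ m := by simp at h; lia
        exact_mod_cast this
      have : 1 ≤ (m : ℝ) / n := (one_le_div hn').2 hm
      rw [zero_sub, abs_neg, abs_one]
      nlinarith
  have hsum : HasSum (fun m => gaussTerm a σ m * T m)
      (∑ m ∈ range (n + 1), gaussTerm a σ m * truncFactor a β σ n m) := by
    rw [Finset.sum_congr rfl fun m hm => show gaussTerm a σ m * truncFactor a β σ n m =
      gaussTerm a σ m * T m by simp only [hT, if_pos hm]]
    exact hasSum_sum_of_ne_finset_zero fun m hm => by simp only [hT, if_neg hm, mul_zero]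
  have hle : ∀ m, ‖gaussTerm a σ m * T m - gaussTerm a σ m‖ ≤
      K * (n : ℝ)⁻¹ * ((m : ℝ) * |gaussTerm a σ m|) := fun m => by
    rw [← mul_sub_one, norm_mul, Real.norm_eq_abs, Real.norm_eq_abs]
    calc _ ≤ |gaussTerm a σ m| * (K * (m / n)) := by gcongr; exact hT1 m
      _ = _ := by ring
  rw [← (hsum.sub hG).tsum_eq]
  refine (tsum_of_norm_bounded (hS.hasSum.mul_left _) hle).trans (le_of_eq ?_)
  ring

theorem integral_nuMeasure_sin_sq {α β : ℝ} (hα : -1 < α) (hβ : -1 < β) (g : ℝ → ℝ) :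
    ∫ θ, g (Real.sin θ ^ 2) ∂(nuMeasure α β) =
      Real.Gamma (α + β + 2) / (Real.Gamma (α + 1) * Real.Gamma (β + 1)) *
        ∫ x in Set.Ioo (0 : ℝ) 1, x ^ α * (1 - x) ^ β * g x := by
  have hG1 := Real.Gamma_pos_of_pos (show 0 < α + 1 by linarith)
  have hG2 := Real.Gamma_pos_of_pos (show 0 < β + 1 by linarith)
  have hG3 := Real.Gamma_pos_of_pos (show 0 < α + β + 2 by linarith)
  have hsin : ∀ θ ∈ Set.Ioo 0 (π / 2), 0 < Real.sin θ := fun θ hθ =>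
    Real.sin_pos_of_pos_of_lt_pi hθ.1 (by linarith [hθ.2, Real.pi_pos])
  have hcos : ∀ θ ∈ Set.Ioo 0 (π / 2), 0 < Real.cos θ := fun θ hθ =>
    Real.cos_pos_of_mem_Ioo ⟨by linarith [hθ.1, Real.pi_pos], hθ.2⟩
  have himage : (fun θ => Real.sin θ ^ 2) '' Set.Ioo 0 (π / 2) = Set.Ioo (0 : ℝ) 1 := by
    ext x
    constructor
    · rintro ⟨θ, hθ, rfl⟩
      have h1 := hsin θ hθ
      have h2 := hcos θ hθ
      exact ⟨by positivity, by nlinarith [Real.sin_sq_add_cos_sq θ]⟩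
    · intro hx
      have h0 : 0 < √x := Real.sqrt_pos.2 hx.1
      have h1 : √x < 1 := (Real.sqrt_lt' one_pos).2 (by linarith [hx.2])
      exact ⟨Real.arcsin √x, ⟨Real.arcsin_pos.2 h0, Real.arcsin_lt_pi_div_two.2 h1⟩, by
        simp only [Real.sin_arcsin (by linarith : -1 ≤ √x) h1.le, Real.sq_sqrt hx.1.le]⟩
  have hinj : Set.InjOn (fun θ => Real.sin θ ^ 2) (Set.Ioo 0 (π / 2)) := fun θ hθ φ hφ h =>
    Real.injOn_sin ⟨by linarith [hθ.1, Real.pi_pos], hθ.2.le⟩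
      ⟨by linarith [hφ.1, Real.pi_pos], hφ.2.le⟩
      ((sq_eq_sq₀ (hsin θ hθ).le (hsin φ hφ).le).1 h)
  have hderiv : ∀ θ ∈ Set.Ioo 0 (π / 2), HasDerivWithinAt (fun θ => Real.sin θ ^ 2)
      (2 * Real.sin θ * Real.cos θ) (Set.Ioo 0 (π / 2)) θ := fun θ _ => by
    simpa using ((Real.hasDerivAt_sin θ).fun_pow 2).hasDerivWithinAt
  rw [nuMeasure, integral_withDensity_eq_integral_toReal_smul (by fun_prop)
    (by simp), ← himage, integral_image_eq_integral_abs_deriv_smul measurableSet_Ioo hderiv hinj,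
    ← integral_const_mul]
  refine setIntegral_congr_fun measurableSet_Ioo fun θ hθ => ?_
  have h1 := hsin θ hθ
  have h2 := hcos θ hθ
  have e1 : Real.sin θ ^ (2 * α + 1) = (Real.sin θ ^ 2) ^ α * Real.sin θ := by
    rw [Real.rpow_add_one h1.ne', Real.rpow_mul h1.le, Real.rpow_two]
  have e2 : Real.cos θ ^ (2 * β + 1) = (1 - Real.sin θ ^ 2) ^ β * Real.cos θ := by
    rw [← Real.cos_sq', Real.rpow_add_one h2.ne', Real.rpow_mul h2.le, Real.rpow_two]
  simp only [smul_eq_mul]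
  rw [ENNReal.toReal_ofReal (by positivity), abs_of_pos (by positivity), e1, e2]
  ring

/-- The part of the energy integral carried by `𝒦_n²`, in the variable `sin² θ`. -/
theorem hasLeadingTerm_integral_KK_sq {α β s : ℝ} (hβ : -1 < β) (hs0 : 0 < s)
    (hs : s < 2 * α + 2) :
    HasLeadingTerm (fun n => Real.Gamma (α + β + 2) / (Real.Gamma (α + 1) * Real.Gamma (β + 1)) *
        ∫ x in Set.Ioo (0 : ℝ) 1, x ^ (α - s / 2) * (1 - x) ^ β * KK α β n (1 - 2 * x) ^ 2)
      (Real.Gamma (s + 1) * Real.Gamma (α + 1 - s / 2) * Real.Gamma (β + 1) /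
        (Real.Gamma (s / 2 + 1) ^ 2 * Real.Gamma (α + 2 + s / 2) *
          Real.Gamma (α + 1) * Real.Gamma (α + β + 2))) (s + 2 * α + 2) := by
  obtain ⟨a, rfl⟩ : ∃ a, α = a + s / 2 := ⟨α - s / 2, by ring⟩
  obtain ⟨σ, rfl⟩ : ∃ σ, s = 2 * σ := ⟨s / 2, by ring⟩
  rw [mul_div_cancel_left₀ σ two_ne_zero]
  have ha : -1 < a := by linarith
  have hσ : 0 < σ := by linarith
  have key (n : ℕ) := integral_rpow_mul_jacobiP_sq ha hβ hσ n
  have pAB := hasLeadingTerm_poch (show 0 < a + σ + β + 2 by linarith)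
  have pB := hasLeadingTerm_poch (show 0 < β + 1 by linarith)
  have paB := hasLeadingTerm_poch (show 0 < a + β + 2 by linarith)
  have pa := hasLeadingTerm_poch (show 0 < a + σ + 2 by linarith)
  have ps := hasLeadingTerm_poch (show 0 < σ + 1 by linarith)
  have hS := hasLeadingTerm_sum_gaussTerm_mul_truncFactor ha hβ hσ
  have gAB := Real.Gamma_pos_of_pos (show 0 < a + σ + β + 2 by linarith)
  have gB := Real.Gamma_pos_of_pos (show 0 < β + 1 by linarith)
  have gaB := Real.Gamma_pos_of_pos (show 0 < a + β + 2 by linarith)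
  have ga := Real.Gamma_pos_of_pos (show 0 < a + σ + 2 by linarith)
  have gs := Real.Gamma_pos_of_pos (show 0 < σ + 1 by linarith)
  have ga1 := Real.Gamma_pos_of_pos (show 0 < a + 1 by linarith)
  have gA1 := Real.Gamma_pos_of_pos (show 0 < a + σ + 1 by linarith)
  have ga2 := Real.Gamma_pos_of_pos (show 0 < a + 2 * σ + 2 by linarith)
  have H := (HasLeadingTerm.const (Real.Gamma (a + σ + β + 2) /
      (Real.Gamma (a + σ + 1) * Real.Gamma (β + 1)) *
      (Real.Gamma (β + 1) * Real.Gamma (a + 1) / Real.Gamma (a + β + 2)))).mul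
    ((pAB.mul pAB).mul ((pB.inv (inv_ne_zero gB.ne')).mul
      ((paB.inv (inv_ne_zero gaB.ne')).mul (pa.mul (ps.mul hS)))))
  convert H.congr' (Eventually.of_forall fun n => ?_) using 1
  · rw [show a + σ + 1 - σ = a + 1 by ring,
      show a + σ + 2 + σ = a + 2 * σ + 2 by ring]
    field_simp
  · ring
  · have hn : (n.factorial : ℝ) ≠ 0 := by positivity
    have hp := (poch_pos (show 0 < β + 1 by linarith) n).ne'
    have hp2 := (poch_pos (show 0 < a + β + 2 by linarith) n).ne'
    simp only [KK, mul_pow, mul_left_comm _ ((_ : ℝ) ^ 2), integral_const_mul]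
    rw [show a + σ - σ = a by ring, key]
    field_simp

theorem integral_energy_eq {α β s : ℝ} (hα : -1 < α) (hβ : -1 < β) (hs : s < 2 * α + 2) (n : ℕ) :
    ∫ θ, Real.sin θ ^ (-s) * (KK α β n 1 ^ 2 - KK α β n (Real.cos (2 * θ)) ^ 2) ∂(nuMeasure α β) =
      Real.Gamma (α + β + 2) * Real.Gamma (α + 1 - s / 2) /
        (Real.Gamma (α + 1) * Real.Gamma (α + β + 2 - s / 2)) * KK α β n 1 ^ 2 -
      Real.Gamma (α + β + 2) / (Real.Gamma (α + 1) * Real.Gamma (β + 1)) *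
        ∫ x in Set.Ioo (0 : ℝ) 1, x ^ (α - s / 2) * (1 - x) ^ β * KK α β n (1 - 2 * x) ^ 2 := by
  have ha : -1 < α - s / 2 := by linarith
  have hG2 := (Real.Gamma_pos_of_pos (show 0 < β + 1 by linarith)).ne'
  have hcont : Continuous fun x : ℝ => KK α β n (1 - 2 * x) ^ 2 := by
    have := continuous_jacobiP (α + 1) β n
    unfold KK
    fun_prop
  have e1 : ∫ θ, Real.sin θ ^ (-s) * (KK α β n 1 ^ 2 - KK α β n (Real.cos (2 * θ)) ^ 2)
      ∂(nuMeasure α β) = ∫ θ, (Real.sin θ ^ 2) ^ (-(s / 2)) *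
        (KK α β n 1 ^ 2 - KK α β n (1 - 2 * Real.sin θ ^ 2) ^ 2) ∂(nuMeasure α β) := by
    refine integral_congr_ae ((withDensity_absolutelyContinuous _ _).ae_le ?_)
    filter_upwards [ae_restrict_mem measurableSet_Ioo] with θ hθ
    have h := Real.sin_pos_of_pos_of_lt_pi hθ.1 (by linarith [hθ.2, Real.pi_pos])
    have e : Real.sin θ ^ (-s) = (Real.sin θ ^ 2) ^ (-(s / 2)) := by
      rw [← Real.rpow_two, ← Real.rpow_mul h.le]
      ring_nf
    rw [e, Real.cos_two_mul, Real.cos_sq']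
    ring_nf
  have e2 : ∀ x ∈ Set.Ioo (0 : ℝ) 1, x ^ α * (1 - x) ^ β *
      (x ^ (-(s / 2)) * (KK α β n 1 ^ 2 - KK α β n (1 - 2 * x) ^ 2)) =
      x ^ (α - s / 2) * (1 - x) ^ β * KK α β n 1 ^ 2 -
        x ^ (α - s / 2) * (1 - x) ^ β * KK α β n (1 - 2 * x) ^ 2 := fun x hx => by
    rw [sub_eq_add_neg α, Real.rpow_add hx.1]
    ring
  rw [e1, integral_nuMeasure_sin_sq hα hβ
    fun x => x ^ (-(s / 2)) * (KK α β n 1 ^ 2 - KK α β n (1 - 2 * x) ^ 2),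
    setIntegral_congr_fun measurableSet_Ioo e2,
    integral_sub ((integrableOn_beta ha hβ).mul_const _) (integrableOn_beta_mul ha hβ hcont),
    integral_mul_const, integral_beta ha hβ, show α - s / 2 + 1 = α + 1 - s / 2 by ring,
    show α - s / 2 + β + 2 = α + β + 2 - s / 2 by ring]
  field_simp

theorem IsProjParam.neg_one_lt {α β : ℝ} (h : IsProjParam α β) : -1 < α ∧ -1 < β := by
  have cast {d : ℕ} (hd : 3 ≤ d) : (3 : ℝ) ≤ d := by exact_mod_cast hd
  rcases h with ⟨d, hd, rfl, rfl⟩ | ⟨d, hd, rfl, rfl⟩ | ⟨d, hd, rfl, rfl⟩ | ⟨rfl, rfl⟩ <;>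
    constructor <;> first | linarith [cast hd] | norm_num

/-- The expected chordal Riesz `s`-energy of the harmonic ensemble, `0 < s < 2α+2`. -/
theorem stmt11 (α β s : ℝ) (h : IsProjParam α β) (hs0 : 0 < s) (hs : s < 2 * α + 2) :
    (fun n : ℕ =>
        (∫ θ, Real.sin θ ^ (-s) * (KK α β n 1 ^ 2 - KK α β n (Real.cos (2 * θ)) ^ 2)
            ∂(nuMeasure α β))
          - (Real.Gamma (α + β + 2) * Real.Gamma (α + 1 - s / 2) /
                (Real.Gamma (α + 1) * Real.Gamma (α + β + 2 - s / 2)) * KK α β n 1 ^ 2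
              - Real.Gamma (s + 1) * Real.Gamma (α + 1 - s / 2) * Real.Gamma (β + 1) /
                  (Real.Gamma (s / 2 + 1) ^ 2 * Real.Gamma (α + 2 + s / 2) *
                    Real.Gamma (α + 1) * Real.Gamma (α + β + 2)) *
                  (n : ℝ) ^ (s + 2 * α + 2)))
      =O[atTop] fun n : ℕ => (n : ℝ) ^ (s + 2 * α + 1) := by
  obtain ⟨hα, hβ⟩ := h.neg_one_lt
  have H := (hasLeadingTerm_integral_KK_sq hβ hs0 hs).neg_left
  rw [show s + 2 * α + 2 - 1 = s + 2 * α + 1 by ring] at H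
  refine H.congr_left fun n => ?_
  rw [integral_energy_eq hα hβ hs]
  ring
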